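/- For all integers m ≥ 1 and 1 ≤ j ≤ m, and every real z with 0 < z < 1/2, ∑_{n₁>n₂>⋯>n_m>0} z^{n_j} / ( n₁ · ∏_{i≠j} (n_i − n_j) ) = −∑_{c} Li_c(z/(z−1)), where the sum on the right ranges over all compositions c = (c₁,…,c_{m−j+1}) of m into m−j+1 positive integer parts. -/

import Mathlib

open scoped BigOperators

/-- The multiple polylogarithm `Li_{k₁,…,k_l}(w) = ∑_{n₁ > ⋯ > n_l > 0}
w^{n₁} / (n₁^{k₁} ⋯ n_l^{k_l})`, indexed by a list `k = [k₁, …, k_l]`;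
for the empty list it is the constant `1`. -/
noncomputable def MPL (k : List ℕ) (w : ℝ) : ℝ :=
  ∑' n : {n : Fin k.length → ℕ // StrictAnti n ∧ ∀ i, 0 < n i},
    (if h : 0 < k.length then w ^ (n.1 ⟨0, h⟩) else 1) /
      ∏ i, ((n.1 i : ℝ)) ^ (k.get i)

section

open Finset

/-- The elementary symmetric sum `∑_{N > n₁ > ⋯ > n_k > 0} u n₁ ⋯ u n_k`, with value `0`
at `N = 0`. -/
noncomputable def elemSum (u : ℕ → ℝ) : ℕ → ℕ → ℝ
  | 0, N => if N = 0 then 0 else 1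
  | k + 1, N => ∑ n ∈ range N, u n * elemSum u k n

/-- The multiple harmonic star sum `∑_{N ≥ n₁ ≥ ⋯ ≥ n_p > 0} 1 / (n₁ ⋯ n_p)`. -/
noncomputable def starSum : ℕ → ℕ → ℝ
  | 0, _ => 1
  | p + 1, N => ∑ i ∈ range N, starSum p (i + 1) / (i + 1 : ℝ)

/-- The sum of all multiple harmonic sums of depth `l` and weight `l + p` truncated below `N`. -/
noncomputable def weightSum : ℕ → ℕ → ℕ → ℝ
  | 0, p, N => if N = 0 ∨ p ≠ 0 then 0 else 1
  | l + 1, p, N => ∑ n ∈ range N, ∑ x ∈ antidiagonal p,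
      (1 / (n : ℝ)) ^ (x.1 + 1) * weightSum l x.2 n

/-- The coefficient of `w ^ n` in the sum of all multiple polylogarithms of depth `l + 1` and
weight `l + 1 + p`. -/
noncomputable def polylogCoeff (l p n : ℕ) : ℝ :=
  ∑ x ∈ antidiagonal p, (1 / (n : ℝ)) ^ (x.1 + 1) * weightSum l x.2 n

lemma elemSum_apply_zero (u : ℕ → ℝ) (k : ℕ) : elemSum u k 0 = 0 := by
  cases k <;> simp [elemSum]

lemma elemSum_succ_succ (u : ℕ → ℝ) (k N : ℕ) :
    elemSum u (k + 1) (N + 1) = elemSum u (k + 1) N + u N * elemSum u k N := by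
  simp [elemSum, sum_range_succ]

lemma starSum_succ_succ (p N : ℕ) :
    starSum (p + 1) (N + 1) = starSum (p + 1) N + starSum p (N + 1) / (N + 1 : ℝ) := by
  simp [starSum, sum_range_succ]

lemma starSum_one (p : ℕ) : starSum p 1 = 1 := by
  induction p with
  | zero => rfl
  | succ p ih => simp [starSum, ih]

lemma weightSum_succ_succ (l p N : ℕ) :
    weightSum (l + 1) p (N + 1) = weightSum (l + 1) p N + polylogCoeff l p N := by
  simp [weightSum, polylogCoeff, sum_range_succ]

lemma weightSum_nonneg (l p n : ℕ) : 0 ≤ weightSum l p n := by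
  induction l generalizing p n with
  | zero => simp only [weightSum]; split_ifs <;> norm_num
  | succ l ih =>
    exact sum_nonneg fun n _ => sum_nonneg fun x _ => mul_nonneg (by positivity) (ih _ _)

lemma polylogCoeff_nonneg (l p n : ℕ) : 0 ≤ polylogCoeff l p n :=
  sum_nonneg fun x _ => mul_nonneg (by positivity) (weightSum_nonneg _ _ _)

lemma polylogCoeff_apply_zero (l p : ℕ) : polylogCoeff l p 0 = 0 := by
  simp [polylogCoeff]

lemma mul_polylogCoeff_zero (l n : ℕ) :
    (n + 1 : ℝ) * polylogCoeff l 0 (n + 1) = weightSum l 0 (n + 1) := by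
  simp only [polylogCoeff, Nat.antidiagonal_zero, sum_singleton]
  push_cast
  field_simp

lemma mul_polylogCoeff_succ (l p n : ℕ) :
    (n + 1 : ℝ) * polylogCoeff l (p + 1) (n + 1) =
      weightSum l (p + 1) (n + 1) + polylogCoeff l p (n + 1) := by
  have hn : (n + 1 : ℝ) ≠ 0 := by positivity
  rw [polylogCoeff, Nat.antidiagonal_succ, sum_cons, sum_map, mul_add, polylogCoeff, mul_sum]
  congr 1
  · push_cast
    field_simp
  · refine sum_congr rfl fun x _ => ?_
    simp only [Function.Embedding.prodMap, Function.Embedding.coeFn_mk, Prod.map,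
      Nat.succ_eq_add_one, Function.Embedding.refl_apply]
    push_cast
    rw [pow_succ]
    field_simp

/-- The binomial transform `M ↦ ∑ r ≤ M, (-1) ^ r * (M.choose r) * f r`. -/
def binomialTransform (f : ℕ → ℝ) (M : ℕ) : ℝ :=
  ∑ r ∈ range (M + 1), (-1) ^ r * (M.choose r : ℝ) * f r

lemma binomialTransform_succ (f : ℕ → ℝ) (M : ℕ) :
    binomialTransform f (M + 1) =
      binomialTransform f M - binomialTransform (fun r => f (r + 1)) M := by
  unfold binomialTransform
  rw [sum_range_succ' _ (M + 1), sum_range_succ' (fun r => (-1) ^ r * (M.choose r : ℝ) * f r) M,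
    sum_congr rfl (g := fun r => (-1) ^ (r + 1) * (M.choose (r + 1) : ℝ) * f (r + 1) -
      (-1) ^ r * (M.choose r : ℝ) * f (r + 1)), sum_sub_distrib,
    sum_range_succ (fun r => (-1) ^ (r + 1) * (M.choose (r + 1) : ℝ) * f (r + 1))]
  · simp
    ring
  · intro r _
    rw [Nat.choose_succ_succ]
    push_cast
    ring

lemma binomialTransform_succ_mul (f : ℕ → ℝ) (M : ℕ) :
    binomialTransform (fun r => (r + 1 : ℝ) * f r) (M + 1) =
      (M + 2 : ℝ) * binomialTransform f (M + 1) - (M + 1 : ℝ) * binomialTransform f M := by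
  have h : binomialTransform f M =
      ∑ r ∈ range (M + 2), (-1) ^ r * (M.choose r : ℝ) * f r := by
    rw [sum_range_succ]
    simp [binomialTransform]
  rw [h]
  unfold binomialTransform
  rw [mul_sum, mul_sum, ← sum_sub_distrib]
  refine sum_congr rfl fun r hr => ?_
  have hr' : r ≤ M + 1 := by simpa [Nat.lt_succ_iff] using hr
  have key := Nat.choose_mul_succ_eq M r
  have key' : (M.choose r : ℝ) * (M + 1) = ((M + 1).choose r : ℝ) * (M + 1 - r) := by
    have := congrArg (Nat.cast (R := ℝ)) key
    push_cast [Nat.cast_sub hr'] at this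
    exact this
  linear_combination (-1) ^ r * f r * key'

lemma binomialTransform_add (f g : ℕ → ℝ) (M : ℕ) :
    binomialTransform (fun r => f r + g r) M = binomialTransform f M + binomialTransform g M := by
  simp [binomialTransform, mul_add, sum_add_distrib]

lemma binomialTransform_weightSum_zero (p M : ℕ) :
    binomialTransform (fun r => weightSum 0 p (r + 1)) (M + 1) = 0 := by
  rw [binomialTransform_succ]
  simp [weightSum]

lemma binomialTransform_weightSum_succ (k p M : ℕ) :
    binomialTransform (fun r => weightSum (k + 1) p (r + 1)) (M + 1) =
      -binomialTransform (fun r => polylogCoeff k p (r + 1)) M := by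
  rw [binomialTransform_succ, sub_eq_iff_eq_add, ← sub_eq_iff_eq_add', sub_neg_eq_add]
  simp_rw [weightSum_succ_succ k p (_ + 1)]
  rw [binomialTransform_add]

lemma binomialTransform_polylogCoeff_zero_right (k M : ℕ) :
    (M + 2 : ℝ) * binomialTransform (fun r => polylogCoeff k 0 (r + 1)) (M + 1) =
      (M + 1 : ℝ) * binomialTransform (fun r => polylogCoeff k 0 (r + 1)) M +
        binomialTransform (fun r => weightSum k 0 (r + 1)) (M + 1) := by
  have h := binomialTransform_succ_mul (fun r => polylogCoeff k 0 (r + 1)) M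
  simp_rw [mul_polylogCoeff_zero] at h
  linarith

lemma binomialTransform_polylogCoeff_succ_right (k p M : ℕ) :
    (M + 2 : ℝ) * binomialTransform (fun r => polylogCoeff k (p + 1) (r + 1)) (M + 1) =
      (M + 1 : ℝ) * binomialTransform (fun r => polylogCoeff k (p + 1) (r + 1)) M +
        binomialTransform (fun r => weightSum k (p + 1) (r + 1)) (M + 1) +
        binomialTransform (fun r => polylogCoeff k p (r + 1)) (M + 1) := by
  have h := binomialTransform_succ_mul (fun r => polylogCoeff k (p + 1) (r + 1)) M
  simp_rw [mul_polylogCoeff_succ, binomialTransform_add] at h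
  linarith

lemma weightSum_one (l p : ℕ) : weightSum (l + 1) p 1 = 0 := by
  simp [weightSum]

lemma polylogCoeff_zero_one (p : ℕ) : polylogCoeff 0 p 1 = 1 := by
  induction p with
  | zero => simpa [weightSum] using mul_polylogCoeff_zero 0 0
  | succ p ih =>
    have h := mul_polylogCoeff_succ 0 p 0
    simpa [weightSum, ih] using h

lemma polylogCoeff_succ_one (l p : ℕ) : polylogCoeff (l + 1) p 1 = 0 := by
  simp [polylogCoeff, weightSum_one]

/-- Chu–Vandermonde: the binomial transform of the polylogarithm coefficients factors. -/
lemma binomialTransform_polylogCoeff (k p M : ℕ) :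
    binomialTransform (fun r => polylogCoeff k p (r + 1)) M =
      (-1) ^ k * elemSum (fun n => 1 / (n : ℝ)) k (M + 1) * starSum p (M + 1) / (M + 1 : ℝ) := by
  induction M generalizing k p with
  | zero =>
    cases k with
    | zero => simp [binomialTransform, polylogCoeff_zero_one, elemSum, starSum_one]
    | succ k => simp [binomialTransform, polylogCoeff_succ_one, elemSum]
  | succ M ihM =>
    have h2 : (M + 2 : ℝ) ≠ 0 := by positivity
    have h1 : (M + 1 : ℝ) ≠ 0 := by positivity
    refine mul_left_cancel₀ h2 ?_
    induction p with
    | zero =>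
      rw [binomialTransform_polylogCoeff_zero_right]
      cases k with
      | zero =>
        rw [binomialTransform_weightSum_zero, ihM]
        simp only [elemSum, starSum]
        push_cast
        norm_num
        field_simp
        ring
      | succ k =>
        rw [binomialTransform_weightSum_succ, ihM, ihM, elemSum_succ_succ _ k (M + 1)]
        simp only [starSum]
        push_cast
        field_simp
        ring
    | succ p ihp =>
      have ihp' := mul_left_cancel₀ h2 ihp
      rw [binomialTransform_polylogCoeff_succ_right, ihp', starSum_succ_succ p (M + 1)]
      cases k with
      | zero =>
        rw [binomialTransform_weightSum_zero, ihM]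
        simp only [elemSum]
        push_cast
        norm_num
        field_simp
        ring
      | succ k =>
        rw [binomialTransform_weightSum_succ, ihM, ihM, elemSum_succ_succ _ k (M + 1)]
        push_cast
        field_simp
        ring

/-- Strictly decreasing `l`-tuples of positive integers. -/
abbrev DecTuple (l : ℕ) : Type := {n : Fin l → ℕ // StrictAnti n ∧ ∀ i, 0 < n i}

/-- The first entry of a tuple, or `0` if the tuple is empty. -/
def tupleHead : {l : ℕ} → (Fin l → ℕ) → ℕ
  | 0, _ => 0
  | _ + 1, n => n 0

@[simp]
lemma tupleHead_cons {l n : ℕ} (b : Fin l → ℕ) :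
    tupleHead (Fin.cons n b : Fin (l + 1) → ℕ) = n := rfl

lemma le_tupleHead {l : ℕ} {n : Fin l → ℕ} (hn : StrictAnti n) (i : Fin l) : n i ≤ tupleHead n := by
  cases l with
  | zero => exact i.elim0
  | succ l => exact hn.antitone (Fin.zero_le i)

lemma strictAnti_cons_pos_iff {l : ℕ} {b : Fin l → ℕ} {n : ℕ} :
    (StrictAnti (Fin.cons n b : Fin (l + 1) → ℕ) ∧
        ∀ i, 0 < (Fin.cons n b : Fin (l + 1) → ℕ) i) ↔
      tupleHead b < n ∧ StrictAnti b ∧ ∀ i, 0 < b i := by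
  cases l with
  | zero => simp [tupleHead, Fin.forall_fin_succ, Subsingleton.strictAnti]
  | succ l =>
    have := strictAnti_vecCons (a := n) (f := b)
    rw [Matrix.vecCons] at this
    rw [this, Fin.forall_fin_succ]
    simp only [Fin.cons_zero, Fin.cons_succ, tupleHead]
    constructor
    · rintro ⟨⟨h, hb⟩, -, hp⟩
      exact ⟨h, hb, hp⟩
    · rintro ⟨h, hb, hp⟩
      exact ⟨⟨h, hb⟩, by omega, hp⟩

/-- Decreasing `(l + 1)`-tuples are pairs of a decreasing `l`-tuple and a larger integer. -/
def consDecTuple (l : ℕ) :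
    {q : ℕ × DecTuple l | tupleHead q.2.1 < q.1} ≃ DecTuple (l + 1) where
  toFun q := ⟨Fin.cons q.1.1 q.1.2.1, strictAnti_cons_pos_iff.2 ⟨q.2, q.1.2.2⟩⟩
  invFun n :=
    have h := strictAnti_cons_pos_iff.1 ((Fin.cons_self_tail n.1).symm ▸ n.2)
    ⟨(n.1 0, ⟨Fin.tail n.1, h.2⟩), h.1⟩
  left_inv q := by simp
  right_inv n := by simp

lemma hasSum_decTuple_succ_iff {l : ℕ} {f : (Fin (l + 1) → ℕ) → ℝ} {a : ℝ} :
    HasSum (fun n : DecTuple (l + 1) => f n.1) a ↔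
      HasSum (fun q : ℕ × DecTuple l =>
        if tupleHead q.2.1 < q.1 then f (Fin.cons q.1 q.2.1) else 0) a := by
  rw [← (consDecTuple l).hasSum_iff]
  refine (hasSum_subtype_iff_indicator (f := fun q : ℕ × DecTuple l =>
    f (Fin.cons q.1 q.2.1))).trans ?_
  refine iff_of_eq (congrArg (HasSum · a _) ?_)
  ext q
  simp [Set.indicator_apply]

lemma HasSum.of_eq {α : Type*} {f g : α → ℝ} {a b : ℝ} (h : HasSum f a) (hfg : ∀ x, g x = f x)
    (hab : b = a) : HasSum g b := by
  rwa [hab, funext hfg]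

lemma hasSum_prod_of_nonneg {α β : Type*} {f : α × β → ℝ} (hf : ∀ x, 0 ≤ f x) {g : α → ℝ}
    (hg : ∀ x, HasSum (fun y => f (x, y)) (g x)) {a : ℝ} (ha : HasSum g a) : HasSum f a := by
  have hs : Summable f := (summable_prod_of_nonneg hf).2
    ⟨fun x => (hg x).summable, by simpa only [(hg _).tsum_eq] using ha.summable⟩
  rw [← (hs.hasSum.prod_fiberwise hg).unique ha]
  exact hs.hasSum

lemma hasSum_ite_lt {N : ℕ} (g : ℕ → ℝ) :
    HasSum (fun n => if n < N then g n else 0) (∑ n ∈ range N, g n) := by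
  have h : ∀ n ∉ range N, (if n < N then g n else 0) = 0 := fun n hn => by
    rw [if_neg (by simpa using hn)]
  refine (hasSum_sum_of_ne_finset_zero h).of_eq (fun _ => rfl) ?_
  exact sum_congr rfl fun n hn => by rw [if_pos (by simpa using hn)]

lemma hasSum_decTuple_zero (f : (Fin 0 → ℕ) → ℝ) :
    HasSum (fun n : DecTuple 0 => f n.1) (f Fin.elim0) := by
  let n₀ : DecTuple 0 := ⟨Fin.elim0, Subsingleton.strictAnti _, fun i => i.elim0⟩
  have h := hasSum_single (f := fun n : DecTuple 0 => f n.1) n₀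
    fun n hn => absurd (Subsingleton.elim n n₀) hn
  exact h

lemma hasSum_elemSum {u : ℕ → ℝ} (hu : ∀ n, 0 ≤ u n) (k N : ℕ) :
    HasSum (fun b : DecTuple k => if tupleHead b.1 < N then ∏ i, u (b.1 i) else 0)
      (elemSum u k N) := by
  induction k generalizing N with
  | zero =>
    refine (hasSum_decTuple_zero
      (fun b => if tupleHead b < N then ∏ i, u (b i) else 0)).of_eq (fun _ => rfl) ?_
    simp [elemSum, tupleHead, Nat.pos_iff_ne_zero]
  | succ k ih =>
    refine (hasSum_decTuple_succ_iff
      (f := fun b => if tupleHead b < N then ∏ i, u (b i) else 0)).2 ?_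
    refine hasSum_prod_of_nonneg (fun q => ?_) (fun n => ?_)
      (hasSum_ite_lt (fun n => u n * elemSum u k n))
    · split_ifs <;> first | exact prod_nonneg fun i _ => hu _ | rfl
    · by_cases hn : n < N
      · refine ((ih n).mul_left (u n)).of_eq (fun b => ?_) ?_
        · simp [hn, Fin.prod_univ_succ]
        · simp [hn]
      · simp [hn, hasSum_zero]

/-- `∑ ∏ i, n i ^ (-c i)` over all compositions `c` of `l + p` into `l` parts. -/
noncomputable def compositionWeight (l p : ℕ) (n : Fin l → ℕ) : ℝ :=
  ∑ d ∈ Nat.antidiagonalTuple l p, ∏ i, (1 / (n i : ℝ)) ^ (d i + 1)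

lemma compositionWeight_nonneg (l p : ℕ) (n : Fin l → ℕ) : 0 ≤ compositionWeight l p n :=
  sum_nonneg fun d _ => prod_nonneg fun i _ => by positivity

lemma sum_antidiagonalTuple_succ (l p : ℕ) (f : (Fin (l + 1) → ℕ) → ℝ) :
    ∑ d ∈ Nat.antidiagonalTuple (l + 1) p, f d =
      ∑ x ∈ antidiagonal p, ∑ d ∈ Nat.antidiagonalTuple l x.2, f (Fin.cons x.1 d) := by
  rw [sum_sigma']
  symm
  refine sum_bij' (fun y _ => Fin.cons y.1.1 y.2)
    (fun d _ => ⟨(d 0, ∑ i, Fin.tail d i), Fin.tail d⟩) ?_ ?_ ?_ ?_ ?_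
  · rintro ⟨⟨a, b⟩, d⟩ h
    simp_all [Nat.mem_antidiagonalTuple, Fin.sum_univ_succ]
  · intro d h
    simp_all [Nat.mem_antidiagonalTuple, Fin.sum_univ_succ, Fin.tail]
  · rintro ⟨⟨a, b⟩, d⟩ h
    simp_all [Nat.mem_antidiagonalTuple]
  · intro d h
    simp
  · intro y h
    rfl

lemma compositionWeight_cons (l p n : ℕ) (b : Fin l → ℕ) :
    compositionWeight (l + 1) p (Fin.cons n b) =
      ∑ x ∈ antidiagonal p, (1 / (n : ℝ)) ^ (x.1 + 1) * compositionWeight l x.2 b := by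
  rw [compositionWeight, sum_antidiagonalTuple_succ]
  refine sum_congr rfl fun x _ => ?_
  rw [compositionWeight, mul_sum]
  refine sum_congr rfl fun d _ => ?_
  rw [Fin.prod_univ_succ]
  simp only [Fin.cons_zero, Fin.cons_succ]

lemma hasSum_compositionWeight_cons {l : ℕ} {n : ℕ}
    (h : ∀ p, HasSum (fun b : DecTuple l =>
      if tupleHead b.1 < n then compositionWeight l p b.1 else 0) (weightSum l p n)) (p : ℕ) :
    HasSum (fun b : DecTuple l =>
      if tupleHead b.1 < n then compositionWeight (l + 1) p (Fin.cons n b.1) else 0)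
      (polylogCoeff l p n) := by
  refine (hasSum_sum (s := antidiagonal p)
    fun x _ => (h x.2).mul_left ((1 / (n : ℝ)) ^ (x.1 + 1))).of_eq (fun b => ?_) rfl
  split_ifs <;> simp [compositionWeight_cons]

lemma hasSum_weightSum (l p N : ℕ) :
    HasSum (fun b : DecTuple l => if tupleHead b.1 < N then compositionWeight l p b.1 else 0)
      (weightSum l p N) := by
  induction l generalizing p N with
  | zero =>
    refine (hasSum_decTuple_zero
      (fun b => if tupleHead b < N then compositionWeight 0 p b else 0)).of_eq (fun _ => rfl) ?_
    rcases N with - | N <;> rcases p with - | p <;>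
      simp [weightSum, tupleHead, compositionWeight]
  | succ l ih =>
    refine (hasSum_decTuple_succ_iff
      (f := fun b => if tupleHead b < N then compositionWeight (l + 1) p b else 0)).2 ?_
    refine hasSum_prod_of_nonneg (fun q => ?_) (fun n => ?_)
      (hasSum_ite_lt (fun n => polylogCoeff l p n))
    · split_ifs <;> first | exact compositionWeight_nonneg _ _ _ | rfl
    · by_cases hn : n < N
      · simpa [hn] using hasSum_compositionWeight_cons (fun p => ih p n) p
      · simp [hn, hasSum_zero]

lemma hasSum_of_hasSum_nat_add {f : ℕ → ℝ} {a : ℝ} (k : ℕ) (hf : ∀ n < k, f n = 0)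
    (h : HasSum (fun n => f (n + k)) a) : HasSum f a := by
  have := (hasSum_nat_add_iff k).1 h
  rwa [sum_eq_zero fun n hn => hf n (mem_range.1 hn), add_zero] at this

lemma hasSum_ite_lt_sub_one_div (c i : ℕ) :
    HasSum (fun n : ℕ => if c < n then 1 / (n + i : ℝ) - 1 / (n + (i + 1) : ℝ) else 0)
      (1 / (c + (i + 1) : ℝ)) := by
  refine hasSum_of_hasSum_nat_add (c + 1) (fun n hn => if_neg (by omega)) ?_
  have hnn : ∀ t : ℕ, 0 ≤ (if c < t + (c + 1) then
      1 / (((t + (c + 1) : ℕ) : ℝ) + i) - 1 / (((t + (c + 1) : ℕ) : ℝ) + (i + 1)) else 0) := by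
    intro t
    rw [if_pos (by omega), sub_nonneg]
    push_cast
    gcongr
    linarith
  rw [hasSum_iff_tendsto_nat_of_nonneg hnn]
  have hsum : ∀ n : ℕ, ∑ t ∈ range n, (if c < t + (c + 1) then
      1 / (((t + (c + 1) : ℕ) : ℝ) + i) - 1 / (((t + (c + 1) : ℕ) : ℝ) + (i + 1)) else 0) =
      1 / (c + (i + 1) : ℝ) - 1 / ((n : ℝ) + (c + 1 + i)) := by
    intro n
    rw [sum_congr rfl (g := fun t : ℕ => 1 / ((t : ℝ) + (c + 1 + i)) -
      1 / (((t + 1 : ℕ) : ℝ) + (c + 1 + i))), sum_range_sub']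
    · push_cast
      ring_nf
    · intro t _
      rw [if_pos (by omega)]
      push_cast
      ring_nf
  simp_rw [hsum]
  have hlim : Filter.Tendsto (fun n : ℕ => 1 / ((n : ℝ) + (c + 1 + i))) Filter.atTop (nhds 0) := by
    simp_rw [one_div]
    exact (Filter.tendsto_atTop_add_const_right _ _ tendsto_natCast_atTop_atTop).inv_tendsto_atTop
  simpa using hlim.const_sub (1 / (c + (i + 1) : ℝ))

lemma hasSum_ite_lt_one_div_mul (c : ℕ) {N : ℕ} (hN : 0 < N) :
    HasSum (fun n : ℕ => if c < n then 1 / ((n + N : ℝ) * n) else 0)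
      ((∑ i ∈ range N, 1 / (c + (i + 1) : ℝ)) / N) := by
  refine ((hasSum_sum (s := range N) fun i _ => hasSum_ite_lt_sub_one_div c i).div_const
    (N : ℝ)).of_eq (fun n => ?_) rfl
  have hN' : (N : ℝ) ≠ 0 := by positivity
  split_ifs with hn
  · have hn' : (n : ℝ) ≠ 0 := Nat.cast_ne_zero.2 (by omega)
    have hnN : (n + N : ℝ) ≠ 0 := by positivity
    have := sum_range_sub' (fun i : ℕ => 1 / (n + i : ℝ)) N
    push_cast at this
    rw [this]
    field_simp
    ring
  · simp

/-- Summing `1 / ((a₁ + N) a₁ ⋯ a_p)` over decreasing tuples gives a multiple harmonic star sum. -/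
lemma hasSum_starSum (p : ℕ) {N : ℕ} (hN : 0 < N) :
    HasSum (fun a : DecTuple p => 1 / ((tupleHead a.1 + N : ℝ) * ∏ i, (a.1 i : ℝ)))
      (starSum p N / N) := by
  induction p generalizing N with
  | zero =>
    refine (hasSum_decTuple_zero
      (fun a => 1 / ((tupleHead a + N : ℝ) * ∏ i, (a i : ℝ)))).of_eq (fun _ => rfl) ?_
    simp [starSum, tupleHead]
  | succ p ih =>
    refine (hasSum_decTuple_succ_iff
      (f := fun a => 1 / ((tupleHead a + N : ℝ) * ∏ i, (a i : ℝ)))).2 ?_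
    rw [← (Equiv.prodComm _ _).hasSum_iff]
    refine hasSum_prod_of_nonneg (g := fun a : DecTuple p => (1 / ∏ i, (a.1 i : ℝ)) *
      ((∑ i ∈ range N, 1 / (tupleHead a.1 + (i + 1) : ℝ)) / N)) (fun q => ?_) (fun a => ?_) ?_
    · simp only [Function.comp]
      split_ifs <;> positivity
    · refine ((hasSum_ite_lt_one_div_mul (tupleHead a.1) hN).mul_left
        (1 / ∏ i, (a.1 i : ℝ))).of_eq (fun n => ?_) rfl
      simp only [Function.comp, Equiv.prodComm_apply, Prod.swap_prod_mk, tupleHead_cons,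
        Fin.prod_univ_succ, Fin.cons_zero, Fin.cons_succ, mul_ite, mul_zero]
      congr 1
      rw [one_div_mul_one_div]
      ring_nf
    · refine ((hasSum_sum (s := range N) fun i _ => ih (Nat.succ_pos i)).div_const
        (N : ℝ)).of_eq (fun a => ?_) ?_
      · rw [← mul_div_assoc, mul_sum]
        congr 1
        refine sum_congr rfl fun i _ => ?_
        push_cast
        rw [one_div_mul_one_div, mul_comm]
      · simp [starSum]

open Polynomial in
lemma elemSum_eq_coeff_prod (u : ℕ → ℝ) (k N : ℕ) :
    elemSum u k (N + 1) = (∏ i ∈ range N, (1 + C (u (i + 1)) * X)).coeff k := by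
  induction N generalizing k with
  | zero => cases k <;> simp [elemSum, elemSum_apply_zero, coeff_one]
  | succ N ih =>
    rw [prod_range_succ, mul_add, mul_one, coeff_add, ← ih, mul_left_comm, coeff_C_mul]
    cases k with
    | zero => simp [elemSum]
    | succ k => rw [elemSum_succ_succ, coeff_mul_X, ← ih]

lemma elemSum_reflect (u : ℕ → ℝ) (k N : ℕ) :
    elemSum (fun n => u (N - n)) k N = elemSum u k N := by
  cases N with
  | zero => simp [elemSum_apply_zero]
  | succ N =>
    rw [elemSum_eq_coeff_prod, elemSum_eq_coeff_prod, ← prod_range_reflect]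
    congr 1
    refine prod_congr rfl fun i hi => ?_
    have hi' : i < N := by simpa using hi
    rw [show N + 1 - (N - 1 - i + 1) = i + 1 by omega]

lemma exists_polylogCoeff_le_of_weightSum_le {l : ℕ}
    (h : ∀ p, ∃ C : ℝ, 0 ≤ C ∧ ∀ n, weightSum l p n ≤ C * (n : ℝ) ^ l) (p : ℕ) :
    ∃ C : ℝ, 0 ≤ C ∧ ∀ n, polylogCoeff l p n ≤ C * (n : ℝ) ^ l := by
  have hmul : ∀ p n, polylogCoeff l p (n + 1) ≤ (n + 1 : ℝ) * polylogCoeff l p (n + 1) :=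
    fun p n => le_mul_of_one_le_left (polylogCoeff_nonneg _ _ _) (by simp)
  induction p with
  | zero =>
    obtain ⟨C, hC, hW⟩ := h 0
    refine ⟨C, hC, fun n => ?_⟩
    cases n with
    | zero => rw [polylogCoeff_apply_zero]; positivity
    | succ n => exact (hmul 0 n).trans ((mul_polylogCoeff_zero l n).le.trans (hW _))
  | succ p ih =>
    obtain ⟨C, hC, hW⟩ := h (p + 1)
    obtain ⟨C', hC', hE⟩ := ih
    refine ⟨C + C', by positivity, fun n => ?_⟩
    cases n with
    | zero => rw [polylogCoeff_apply_zero]; positivity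
    | succ n =>
      refine (hmul _ n).trans ((mul_polylogCoeff_succ l p n).le.trans ?_)
      rw [add_mul]
      exact add_le_add (hW _) (hE _)

lemma exists_weightSum_le (l p : ℕ) :
    ∃ C : ℝ, 0 ≤ C ∧ ∀ n, weightSum l p n ≤ C * (n : ℝ) ^ l := by
  induction l generalizing p with
  | zero =>
    refine ⟨1, zero_le_one, fun n => ?_⟩
    simp only [weightSum]
    split_ifs <;> simp
  | succ l ih =>
    obtain ⟨C, hC, hE⟩ := exists_polylogCoeff_le_of_weightSum_le ih p
    refine ⟨C, hC, fun n => ?_⟩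
    calc weightSum (l + 1) p n = ∑ i ∈ range n, polylogCoeff l p i := rfl
      _ ≤ ∑ _i ∈ range n, C * (n : ℝ) ^ l := by
          refine sum_le_sum fun i hi => (hE i).trans ?_
          have : i ≤ n := (mem_range.1 hi).le
          gcongr
      _ = C * (n : ℝ) ^ (l + 1) := by
          simp
          ring

lemma summable_pow_mul_polylogCoeff (l p : ℕ) {w : ℝ} (hw : |w| < 1) :
    Summable fun n : ℕ => w ^ n * polylogCoeff l p n := by
  obtain ⟨C, -, hE⟩ := exists_polylogCoeff_le_of_weightSum_le (exists_weightSum_le l) p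
  refine Summable.of_norm_bounded (g := fun n : ℕ => C * ((n : ℝ) ^ l * |w| ^ n)) ?_ fun n => ?_
  · exact (summable_pow_mul_geometric_of_norm_lt_one l (by simpa using hw)).mul_left C
  · rw [norm_mul, norm_pow, Real.norm_eq_abs, Real.norm_of_nonneg (polylogCoeff_nonneg _ _ _)]
    calc |w| ^ n * polylogCoeff l p n ≤ |w| ^ n * (C * (n : ℝ) ^ l) := by
          gcongr
          exact hE n
      _ = _ := by ring

lemma hasSum_pow_mul_compositionWeight (k p : ℕ) {w : ℝ} (hw : |w| < 1) :
    HasSum (fun n : DecTuple (k + 1) => w ^ n.1 0 * compositionWeight (k + 1) p n.1)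
      (∑' n, w ^ n * polylogCoeff k p n) := by
  have hfiber : ∀ (v : ℝ) (n : ℕ), HasSum (fun b : DecTuple k => if tupleHead b.1 < n then
      v ^ n * compositionWeight (k + 1) p (Fin.cons n b.1) else 0) (v ^ n * polylogCoeff k p n) :=
    fun v n => ((hasSum_compositionWeight_cons (fun p => hasSum_weightSum k p n) p).mul_left
      (v ^ n)).of_eq (fun b => by simp) rfl
  refine (hasSum_decTuple_succ_iff
    (f := fun n => w ^ n 0 * compositionWeight (k + 1) p n)).2 ?_
  simp only [Fin.cons_zero]
  have habs : HasSum (fun q : ℕ × DecTuple k => if tupleHead q.2.1 < q.1 then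
      |w| ^ q.1 * compositionWeight (k + 1) p (Fin.cons q.1 q.2.1) else 0)
      (∑' n, |w| ^ n * polylogCoeff k p n) := by
    refine hasSum_prod_of_nonneg (g := fun n => |w| ^ n * polylogCoeff k p n)
      (fun q => ?_) (fun n => ?_)
      (summable_pow_mul_polylogCoeff k p (w := |w|) (by simpa using hw)).hasSum
    swap
    · exact hfiber |w| n
    have := compositionWeight_nonneg (k + 1) p (Fin.cons q.1 q.2.1)
    split_ifs <;> positivity
  have hs : Summable (fun q : ℕ × DecTuple k => if tupleHead q.2.1 < q.1 then
      w ^ q.1 * compositionWeight (k + 1) p (Fin.cons q.1 q.2.1) else 0) := by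
    refine Summable.of_norm_bounded habs.summable fun q => ?_
    split_ifs
    · rw [norm_mul, norm_pow, Real.norm_eq_abs, Real.norm_of_nonneg (compositionWeight_nonneg _ _ _)]
    · simp
  rw [(hs.hasSum.prod_fiberwise (hfiber w)).tsum_eq]
  exact hs.hasSum

lemma hasSum_choose_mul_pow (r : ℕ) {z : ℝ} (hz : |z| < 1) :
    HasSum (fun M : ℕ => (M.choose r : ℝ) * z ^ M) (z ^ r / (1 - z) ^ (r + 1)) := by
  refine hasSum_of_hasSum_nat_add r (fun n hn => by simp [Nat.choose_eq_zero_of_lt hn]) ?_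
  refine ((hasSum_choose_mul_geometric_of_norm_lt_one r (r := z) (by simpa using hz)).mul_left
    (z ^ r)).of_eq (fun n => ?_) (by ring)
  ring

/-- The Euler transform of a power series, as the substitution `z ↦ z / (z - 1)`. -/
lemma hasSum_binomialTransform {f : ℕ → ℝ} (hf : ∀ r, 0 ≤ f r) {z : ℝ} (hz0 : 0 < z) (hz : z < 1)
    (hs : Summable fun r => (z / (1 - z)) ^ (r + 1) * f r) :
    HasSum (fun M => z ^ (M + 1) * binomialTransform f M)
      (-∑' r, (z / (z - 1)) ^ (r + 1) * f r) := by
  have h1z : 0 < 1 - z := by linarith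
  have hfiber : ∀ (v : ℝ) (r : ℕ), HasSum (fun M : ℕ => z ^ (M + 1) * (v ^ r * M.choose r * f r))
      (v ^ r * ((z / (1 - z)) ^ (r + 1) * f r)) := fun v r =>
    ((hasSum_choose_mul_pow r (abs_lt.2 ⟨by linarith, hz⟩)).mul_left (z * v ^ r * f r)).of_eq
      (fun M => by ring) (by rw [div_pow]; ring)
  have habs : HasSum (fun q : ℕ × ℕ => z ^ (q.2 + 1) * ((1 : ℝ) ^ q.1 * q.2.choose q.1 * f q.1))
      (∑' r, (1 : ℝ) ^ r * ((z / (1 - z)) ^ (r + 1) * f r)) := by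
    refine hasSum_prod_of_nonneg (fun q => ?_) (hfiber 1) (by simpa using hs.hasSum)
    have := hf q.1
    positivity
  have hsum : Summable (fun q : ℕ × ℕ =>
      z ^ (q.2 + 1) * ((-1 : ℝ) ^ q.1 * q.2.choose q.1 * f q.1)) := by
    refine Summable.of_norm_bounded habs.summable fun q => ?_
    simp [abs_of_pos hz0, abs_of_nonneg (hf q.1)]
  have hval : ∑' q : ℕ × ℕ, z ^ (q.2 + 1) * ((-1 : ℝ) ^ q.1 * q.2.choose q.1 * f q.1) =
      -∑' r, (z / (z - 1)) ^ (r + 1) * f r := by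
    rw [← (hsum.hasSum.prod_fiberwise (hfiber (-1))).tsum_eq, ← tsum_neg]
    refine tsum_congr fun r => ?_
    rw [show z / (z - 1) = -(z / (1 - z)) by rw [← div_neg, neg_sub], neg_pow (z / (1 - z))]
    ring
  rw [← hval]
  refine HasSum.prod_fiberwise (f := fun q : ℕ × ℕ =>
    z ^ (q.1 + 1) * ((-1 : ℝ) ^ q.2 * q.1.choose q.2 * f q.2))
    ((Equiv.prodComm ℕ ℕ).hasSum_iff.2 hsum.hasSum) fun M => ?_
  have h0 : ∀ r ∉ range (M + 1), z ^ (M + 1) * ((-1 : ℝ) ^ r * M.choose r * f r) = 0 := by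
    intro r hr
    rw [Nat.choose_eq_zero_of_lt (by simpa using hr)]
    simp
  refine (hasSum_sum_of_ne_finset_zero h0).of_eq (fun _ => rfl) ?_
  rw [binomialTransform, mul_sum]

lemma MPL_eq_tsum {l : ℕ} (hl : 0 < l) (c : List ℕ) (hc : c.length = l) (w : ℝ) :
    MPL c w = ∑' n : DecTuple l,
      w ^ n.1 ⟨0, hl⟩ * ∏ i, (1 / (n.1 i : ℝ)) ^ c.get (i.cast hc.symm) := by
  subst hc
  refine tsum_congr fun n => ?_
  simp [hl, div_eq_mul_inv]

lemma MPL_ofFn (l : ℕ) (c : Fin (l + 1) → ℕ) (w : ℝ) :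
    MPL (List.ofFn c) w =
      ∑' n : DecTuple (l + 1), w ^ n.1 0 * ∏ i, (1 / (n.1 i : ℝ)) ^ c i := by
  rw [MPL_eq_tsum l.succ_pos _ (List.length_ofFn)]
  refine tsum_congr fun n => ?_
  congr 1
  refine prod_congr rfl fun i _ => ?_
  rw [List.get_ofFn]
  rfl

lemma sum_composition_length_eq (k p m : ℕ) (hm : m = p + (k + 1)) (F : List ℕ → ℝ) :
    ∑ c ∈ univ.filter (fun c : Composition m => c.length = k + 1), F c.blocks =
      ∑ d ∈ Nat.antidiagonalTuple (k + 1) p, F (List.ofFn fun i => d i + 1) := by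
  symm
  refine sum_bij (fun d hd => ⟨List.ofFn fun i => d i + 1, ?_, ?_⟩) ?_ ?_ ?_ ?_
  · intro i hi
    obtain ⟨j, rfl⟩ := (List.mem_ofFn).1 hi
    omega
  · rw [Nat.mem_antidiagonalTuple] at hd
    rw [List.sum_ofFn, sum_add_distrib, hd, hm]
    simp
  · intro d hd
    simp [Composition.length]
  · intro d hd d' hd' h
    have := List.ofFn_injective (congrArg Composition.blocks h)
    funext i
    exact Nat.succ_injective (congrFun this i)
  · intro c hc
    have hc' : c.blocks.length = k + 1 := by simpa using hc
    have hpos : ∀ i : Fin (k + 1), 0 < c.blocks.get (i.cast hc'.symm) :=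
      fun i => c.blocks_pos (List.get_mem _ _)
    have hblocks : (List.ofFn fun i : Fin (k + 1) => c.blocks.get (i.cast hc'.symm) - 1 + 1) =
        c.blocks := by
      refine List.ext_get (by simp [hc']) fun n h₁ h₂ => ?_
      rw [List.get_ofFn]
      exact Nat.sub_add_cancel (hpos _)
    refine ⟨fun i => c.blocks.get (i.cast hc'.symm) - 1, ?_, ?_⟩
    · rw [Nat.mem_antidiagonalTuple]
      have hsum := congrArg List.sum hblocks
      rw [c.blocks_sum, List.sum_ofFn, sum_add_distrib] at hsum
      simp at hsum ⊢
      omega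
    · exact Composition.ext hblocks
  · intro d hd
    rfl

/-- The sum of all multiple polylogarithms of given depth and weight, as a power series. -/
lemma sum_MPL_eq_tsum (k p m : ℕ) (hm : m = p + (k + 1)) {w : ℝ} (hw : |w| < 1) :
    ∑ c ∈ univ.filter (fun c : Composition m => c.length = k + 1), MPL c.blocks w =
      ∑' n, w ^ n * polylogCoeff k p n := by
  rw [sum_composition_length_eq k p m hm (fun c => MPL c w),
    ← (hasSum_pow_mul_compositionWeight k p hw).tsum_eq]
  simp_rw [MPL_ofFn, compositionWeight, mul_sum]
  refine (Summable.tsum_finsetSum fun d hd => ?_).symm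
  refine Summable.of_norm_bounded
    (hasSum_pow_mul_compositionWeight k p (w := |w|) (by simpa using hw)).summable fun n => ?_
  have hnn : ∀ d : Fin (k + 1) → ℕ, 0 ≤ ∏ i, (1 / (n.1 i : ℝ)) ^ (d i + 1) :=
    fun d => prod_nonneg fun i _ => by positivity
  rw [norm_mul, norm_pow, Real.norm_eq_abs, Real.norm_of_nonneg (hnn d)]
  gcongr
  exact single_le_sum (f := fun d : Fin (k + 1) → ℕ => ∏ i, (1 / (n.1 i : ℝ)) ^ (d i + 1))
    (fun d _ => hnn d) hd

lemma strictAnti_append_cons {p k N : ℕ} (a : DecTuple p) (b : DecTuple k)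
    (hb : tupleHead b.1 < N) :
    StrictAnti (Fin.append (fun i => a.1 i + N) (Fin.cons N b.1 : Fin (k + 1) → ℕ)) ∧
      ∀ i, 0 < Fin.append (fun i => a.1 i + N) (Fin.cons N b.1 : Fin (k + 1) → ℕ) i := by
  obtain ⟨hanti, hpos⟩ := strictAnti_cons_pos_iff.2 ⟨hb, b.2⟩
  refine ⟨fun i j => ?_, fun i => ?_⟩
  · refine Fin.addCases (fun i => ?_) (fun i => ?_) i <;>
      refine Fin.addCases (fun j => ?_) (fun j => ?_) j <;> intro hij
    · simpa using a.2.1 (show i < j from hij)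
    · have h := hanti.antitone (Fin.zero_le j)
      have ha := a.2.2 i
      simp only [Fin.append_left, Fin.append_right, Fin.cons_zero] at h ⊢
      omega
    · have h : p + (i : ℕ) < j := hij
      omega
    · have h : p + (i : ℕ) < p + j := hij
      simpa using hanti (show i < j from by omega)
  · refine Fin.addCases (fun i => ?_) (fun i => ?_) i
    · simpa using Or.inl (a.2.2 i)
    · simpa using hpos i

lemma pivot_lt_of_strictAnti {p k : ℕ} {n : Fin (p + (k + 1)) → ℕ} (hn : StrictAnti n)
    (i : Fin p) : n (Fin.natAdd p 0) < n (Fin.castAdd (k + 1) i) :=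
  hn (Fin.lt_def.2 (by simp))

lemma strictAnti_pos_tail_natAdd {p k : ℕ} (n : DecTuple (p + (k + 1))) :
    tupleHead (Fin.tail fun i : Fin (k + 1) => n.1 (Fin.natAdd p i)) < n.1 (Fin.natAdd p 0) ∧
      StrictAnti (Fin.tail fun i : Fin (k + 1) => n.1 (Fin.natAdd p i)) ∧
      ∀ i, 0 < (Fin.tail fun i : Fin (k + 1) => n.1 (Fin.natAdd p i)) i := by
  rw [← strictAnti_cons_pos_iff]
  have h := Fin.cons_self_tail fun i : Fin (k + 1) => n.1 (Fin.natAdd p i)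
  rw [h]
  exact ⟨fun i j hij => n.2.1 (Fin.lt_def.2 (by simpa using hij)), fun i => n.2.2 _⟩

/-- Decreasing tuples split at a pivot `N` into the differences above `N` and the entries
below `N`. -/
def pivotDecTuple (p k : ℕ) :
    {q : ℕ × DecTuple p × DecTuple k | tupleHead q.2.2.1 < q.1} ≃ DecTuple (p + (k + 1)) where
  toFun q := ⟨_, strictAnti_append_cons q.1.2.1 q.1.2.2 q.2⟩
  invFun n :=
    ⟨(n.1 (Fin.natAdd p 0),
      ⟨fun i => n.1 (Fin.castAdd (k + 1) i) - n.1 (Fin.natAdd p 0),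
        fun i j hij => Nat.sub_lt_sub_right (pivot_lt_of_strictAnti n.2.1 j).le
          (n.2.1 (Fin.lt_def.2 hij)),
        fun i => Nat.sub_pos_of_lt (pivot_lt_of_strictAnti n.2.1 i)⟩,
      ⟨Fin.tail fun i : Fin (k + 1) => n.1 (Fin.natAdd p i), (strictAnti_pos_tail_natAdd n).2⟩),
      (strictAnti_pos_tail_natAdd n).1⟩
  left_inv q := by
    simp [Fin.tail_def]
  right_inv n := by
    apply Subtype.ext
    funext i
    refine Fin.addCases (fun i => ?_) (fun i => ?_) i
    · simpa using Nat.sub_add_cancel (pivot_lt_of_strictAnti n.2.1 i).le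
    · refine Fin.cases ?_ (fun i => ?_) i <;> simp [Fin.tail]

lemma hasSum_decTuple_pivot_iff {p k : ℕ} {f : (Fin (p + (k + 1)) → ℕ) → ℝ} {s : ℝ} :
    HasSum (fun n : DecTuple (p + (k + 1)) => f n.1) s ↔
      HasSum (fun q : ℕ × DecTuple p × DecTuple k => if tupleHead q.2.2.1 < q.1 then
        f (Fin.append (fun i => q.2.1.1 i + q.1) (Fin.cons q.1 q.2.2.1 : Fin (k + 1) → ℕ))
        else 0) s := by
  rw [← (pivotDecTuple p k).hasSum_iff]
  refine (hasSum_subtype_iff_indicator (f := fun q : ℕ × DecTuple p × DecTuple k =>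
    f (Fin.append (fun i => q.2.1.1 i + q.1) (Fin.cons q.1 q.2.2.1 : Fin (k + 1) → ℕ)))).trans ?_
  refine iff_of_eq (congrArg (HasSum · s _) ?_)
  ext q
  simp [Set.indicator_apply]

lemma append_cons_apply_zero {p k N : ℕ} (a : Fin p → ℕ) (b : Fin k → ℕ)
    (h : 0 < p + (k + 1)) :
    Fin.append (fun i => a i + N) (Fin.cons N b : Fin (k + 1) → ℕ) ⟨0, h⟩ = tupleHead a + N := by
  cases p with
  | zero =>
    rw [show (⟨0, h⟩ : Fin (0 + (k + 1))) = Fin.natAdd 0 0 from Fin.ext (by simp),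
      Fin.append_right]
    simp [tupleHead]
  | succ p =>
    rw [show (⟨0, h⟩ : Fin (p + 1 + (k + 1))) = Fin.castAdd (k + 1) 0 from Fin.ext (by simp),
      Fin.append_left]
    rfl

lemma prod_erase_pivot {p k : ℕ} (g : Fin (p + (k + 1)) → ℝ) :
    ∏ i ∈ univ.erase (Fin.natAdd p 0), g i =
      (∏ i : Fin p, g (Fin.castAdd (k + 1) i)) * ∏ i : Fin k, g (Fin.natAdd p i.succ) := by
  rw [← filter_ne', prod_filter, Fin.prod_univ_add, Fin.prod_univ_succ]
  have h₁ : ∀ i : Fin p, Fin.castAdd (k + 1) i ≠ Fin.natAdd p 0 := fun i h => by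
    have := congrArg Fin.val h
    simp at this
    omega
  simp [h₁]

lemma pivot_term_eq {p k N : ℕ} (z : ℝ) (a : Fin p → ℕ) {b : Fin k → ℕ}
    (hb : ∀ i, b i < N) (n : Fin (p + (k + 1)) → ℕ)
    (hn : n = Fin.append (fun i => a i + N) (Fin.cons N b : Fin (k + 1) → ℕ))
    (h : 0 < p + (k + 1)) :
    z ^ n (Fin.natAdd p 0) / ((n ⟨0, h⟩ : ℝ) * ∏ i ∈ univ.erase (Fin.natAdd p 0 : Fin _),
      ((n i : ℝ) - (n (Fin.natAdd p 0) : ℝ))) =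
      (-1) ^ k * (z ^ N * (1 / ((tupleHead a + N : ℝ) * ∏ i, (a i : ℝ)) *
        ∏ i, 1 / ((N - b i : ℕ) : ℝ))) := by
  subst hn
  rw [prod_erase_pivot, append_cons_apply_zero]
  have hneg : ∏ i, ((b i : ℝ) - N) = (-1) ^ k * ∏ i, ((N - b i : ℕ) : ℝ) := by
    calc ∏ i, ((b i : ℝ) - N) = ∏ i, (-1) * ((N - b i : ℕ) : ℝ) :=
          prod_congr rfl fun i _ => by
            rw [Nat.cast_sub (hb i).le]
            ring
      _ = _ := by rw [prod_mul_distrib]; simp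
  simp only [Fin.append_left, Fin.append_right, Fin.cons_zero, Fin.cons_succ, Nat.cast_add,
    add_sub_cancel_right, hneg, prod_div_distrib, prod_const_one]
  have hs : ((-1 : ℝ) ^ k)⁻¹ = (-1) ^ k := by
    rw [← inv_pow]
    norm_num
  simp only [div_eq_mul_inv, mul_inv, one_mul, hs]
  ring

lemma hasSum_pivot_fiber (p k : ℕ) {z : ℝ} (N : ℕ) :
    HasSum (fun q : DecTuple p × DecTuple k => if tupleHead q.2.1 < N then
        z ^ N * (1 / ((tupleHead q.1.1 + N : ℝ) * ∏ i, (q.1.1 i : ℝ)) *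
          ∏ i, 1 / ((N - q.2.1 i : ℕ) : ℝ)) else 0)
      (z ^ N * (starSum p N / N * elemSum (fun n => 1 / (n : ℝ)) k N)) := by
  rcases Nat.eq_zero_or_pos N with rfl | hN
  · simp [hasSum_zero]
  · have hb := hasSum_elemSum (u := fun n => 1 / ((N - n : ℕ) : ℝ)) (fun n => by positivity) k N
    rw [elemSum_reflect (fun n => 1 / (n : ℝ))] at hb
    have hprod : HasSum (fun q : DecTuple p × DecTuple k =>
        1 / ((tupleHead q.1.1 + N : ℝ) * ∏ i, (q.1.1 i : ℝ)) *
          if tupleHead q.2.1 < N then ∏ i, 1 / ((N - q.2.1 i : ℕ) : ℝ) else 0)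
        (starSum p N / N * elemSum (fun n => 1 / (n : ℝ)) k N) := by
      refine hasSum_prod_of_nonneg (fun q => ?_) (fun a => ?_)
        ((hasSum_starSum p hN).mul_right (elemSum (fun n => 1 / (n : ℝ)) k N))
      · split_ifs <;> positivity
      · exact hb.mul_left (1 / ((tupleHead a.1 + N : ℝ) * ∏ i, (a.1 i : ℝ)))
    refine (hprod.mul_left (z ^ N)).of_eq (fun q => ?_) rfl
    split_ifs <;> simp

/-- The pivot sum over decreasing tuples in terms of multiple polylogarithms. -/
lemma hasSum_pivot_sum (p k : ℕ) {z : ℝ} (hz0 : 0 < z) (hz : z < 1 / 2) :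
    HasSum (fun n : DecTuple (p + (k + 1)) => z ^ n.1 (Fin.natAdd p 0) /
        ((n.1 ⟨0, by omega⟩ : ℝ) * ∏ i ∈ univ.erase (Fin.natAdd p 0 : Fin (p + (k + 1))),
          ((n.1 i : ℝ) - (n.1 (Fin.natAdd p 0) : ℝ))))
      (-∑ c ∈ univ.filter (fun c : Composition (p + (k + 1)) => c.length = k + 1),
        MPL c.blocks (z / (z - 1))) := by
  have h1z : 0 < 1 - z := by linarith
  have hρ : |z / (1 - z)| < 1 := by
    rw [abs_of_pos (by positivity), div_lt_one h1z]
    linarith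
  have hw : |z / (z - 1)| < 1 := by
    rwa [← abs_neg, ← div_neg, neg_sub]
  rw [sum_MPL_eq_tsum k p _ rfl hw,
    (summable_pow_mul_polylogCoeff k p hw).tsum_eq_zero_add, polylogCoeff_apply_zero, mul_zero,
    zero_add]
  have hs : Summable fun r : ℕ => (z / (1 - z)) ^ (r + 1) * polylogCoeff k p (r + 1) :=
    (summable_nat_add_iff (f := fun n => (z / (1 - z)) ^ n * polylogCoeff k p n) 1).2
      (summable_pow_mul_polylogCoeff k p hρ)
  have hB := hasSum_binomialTransform (f := fun r => polylogCoeff k p (r + 1))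
    (fun r => polylogCoeff_nonneg k p (r + 1)) hz0 (by linarith) hs
  set S : ℝ := -∑' r : ℕ, (z / (z - 1)) ^ (r + 1) * polylogCoeff k p (r + 1)
  have hsq : ((-1 : ℝ) ^ k) * (-1) ^ k = 1 := by
    rw [← mul_pow]
    norm_num
  have hN : HasSum (fun N : ℕ => z ^ N * (starSum p N / N * elemSum (fun n => 1 / (n : ℝ)) k N))
      ((-1) ^ k * S) := by
    refine hasSum_of_hasSum_nat_add 1 (fun n hn => ?_) ?_
    · obtain rfl : n = 0 := by omega
      simp
    · refine (hB.mul_left ((-1) ^ k)).of_eq (fun M => ?_) rfl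
      rw [binomialTransform_polylogCoeff]
      push_cast
      linear_combination (-(z ^ (M + 1) * (starSum p (M + 1) / (M + 1) *
        elemSum (fun n => 1 / (n : ℝ)) k (M + 1)))) * hsq
  refine (hasSum_decTuple_pivot_iff (f := fun n => z ^ n (Fin.natAdd p 0) /
    ((n ⟨0, by omega⟩ : ℝ) * ∏ i ∈ univ.erase (Fin.natAdd p 0 : Fin (p + (k + 1))),
      ((n i : ℝ) - (n (Fin.natAdd p 0) : ℝ))))).2 ?_
  have hprod : HasSum (fun q : ℕ × DecTuple p × DecTuple k => if tupleHead q.2.2.1 < q.1 then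
      z ^ q.1 * (1 / ((tupleHead q.2.1.1 + q.1 : ℝ) * ∏ i, (q.2.1.1 i : ℝ)) *
        ∏ i, 1 / ((q.1 - q.2.2.1 i : ℕ) : ℝ)) else 0) ((-1) ^ k * S) := by
    refine hasSum_prod_of_nonneg (fun q => ?_) (fun N => ?_) hN
    · split_ifs <;> positivity
    · exact hasSum_pivot_fiber p k N
  refine (hprod.mul_left ((-1) ^ k)).of_eq (fun q => ?_) (by rw [← mul_assoc, hsq, one_mul])
  split_ifs with hq
  · exact pivot_term_eq z q.2.1.1 (fun i => (le_tupleHead q.2.2.2.1 i).trans_lt hq) _ rfl _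
  · simp

end

/-- For `m ≥ 1`, `1 ≤ j ≤ m` and `0 < z < 1/2`,
`∑_{n₁ > ⋯ > n_m > 0} z^{n_j} / (n₁ ∏_{i ≠ j} (n_i - n_j))
  = -∑_c Li_c(z/(z-1))`, where the sum on the right ranges over all compositions
`c` of `m` into `m - j + 1` positive parts. -/
theorem landen_connection_lemma (m j : ℕ) (hm : 1 ≤ m) (hj : 1 ≤ j) (hjm : j ≤ m)
    (z : ℝ) (hz0 : 0 < z) (hz : z < 1 / 2) :
    (∑' n : {n : Fin m → ℕ // StrictAnti n ∧ ∀ i, 0 < n i},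
        z ^ (n.1 ⟨j - 1, by omega⟩) /
          ((n.1 ⟨0, by omega⟩ : ℝ) *
            ∏ i ∈ Finset.univ.erase (⟨j - 1, by omega⟩ : Fin m),
              ((n.1 i : ℝ) - (n.1 ⟨j - 1, by omega⟩ : ℝ))))
      = -∑ c ∈ Finset.univ.filter (fun c : Composition m => c.length = m - j + 1),
          MPL c.blocks (z / (z - 1)) := by
  obtain ⟨p, rfl⟩ : ∃ p, j = p + 1 := ⟨j - 1, by omega⟩
  obtain ⟨k, rfl⟩ : ∃ k, m = p + (k + 1) := ⟨m - (p + 1), by omega⟩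
  rw [show p + (k + 1) - (p + 1) + 1 = k + 1 by omega]
  exact (hasSum_pivot_sum p k hz0 hz).tsum_eq
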